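/- Let T be a finite transmission irregular tree of order n ≥ 2, let v be a vertex of T whose transmission is minimum among all vertices of T, and let T₁, …, T_k be the connected components of T − v. Then k ≥ 3 and the orders |T₁|, …, |T_k| are pairwise distinct, each strictly less than n/2. -/

import Mathlib

namespace SimpleGraph

variable {V : Type*} {T : SimpleGraph V}

/-- A walk avoiding `v` stays in one component of the graph with `v` deleted. -/
lemma reachable_induce_compl_singleton {v x y : V} (p : T.Walk x y) (hp : v ∉ p.support)
    (hx : x ∈ ({v}ᶜ : Set V)) (hy : y ∈ ({v}ᶜ : Set V)) :
    (T.induce ({v}ᶜ : Set V)).Reachable ⟨x, hx⟩ ⟨y, hy⟩ :=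
  ⟨p.induce _ <| by rintro z hz rfl; exact hp hz⟩

/-- Every component of a connected graph with `v` deleted contains a neighbour of `v`. -/
lemma Connected.exists_adj_mem_supp (hT : T.Connected) {v : V}
    (c : (T.induce ({v}ᶜ : Set V)).ConnectedComponent) :
    ∃ u : ({v}ᶜ : Set V), T.Adj v u ∧ (T.induce ({v}ᶜ : Set V)).connectedComponentMk u = c := by
  induction c using ConnectedComponent.ind with | _ w =>
  obtain ⟨w, hw⟩ := w
  obtain ⟨p, hp, -⟩ := hT.exists_path_of_dist v w
  cases p with
  | nil => exact absurd rfl hw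
  | @cons _ u _ h p =>
    exact ⟨⟨u, h.ne'⟩, h, ConnectedComponent.sound <|
      reachable_induce_compl_singleton p ((Walk.cons_isPath_iff h p).mp hp).2 _ _⟩

/-- Moving from `v` to an adjacent vertex `u` gets closer to a vertex `w ≠ v` exactly when
`w` is in the component of `u` after deleting `v`. -/
lemma IsTree.dist_add_one_iff_reachable_induce (hT : T.IsTree) {v u w : V} (h : T.Adj v u)
    (hu : u ∈ ({v}ᶜ : Set V)) (hw : w ∈ ({v}ᶜ : Set V)) :
    T.dist v w = T.dist u w + 1 ↔ (T.induce ({v}ᶜ : Set V)).Reachable ⟨w, hw⟩ ⟨u, hu⟩ := by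
  classical
  constructor
  · intro hd
    obtain ⟨p, -, hl⟩ := hT.connected.exists_path_of_dist w u
    refine reachable_induce_compl_singleton p (fun hv => ?_) hw hu
    have h1 := dist_le (p.takeUntil v hv)
    have h2 := p.length_takeUntil_le_length hv
    rw [dist_comm, dist_comm (u := u)] at hd
    omega
  · intro hr
    by_contra hd
    have hd' : T.dist u w = T.dist v w + 1 := by
      have := hT.dist_eq_dist_add_one_of_adj w h
      simp only [dist_comm (u := w)] at this
      tauto
    obtain ⟨p, -, hl⟩ := hT.connected.exists_path_of_dist v w
    have hq : (Walk.cons h.symm p).IsPath :=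
      Walk.isPath_of_length_eq_dist _ (by simp [hl, hd'])
    obtain ⟨r, hpath⟩ := hr.symm.exists_isPath
    obtain ⟨q, hq', hvq⟩ : ∃ q : T.Walk u w, q.IsPath ∧ v ∉ q.support := by
      refine ⟨r.map (Embedding.induce ({v}ᶜ : Set V)).toHom,
        hpath.map Subtype.val_injective, fun hv => ?_⟩
      obtain ⟨z, -, hz⟩ := List.mem_map.mp (Walk.support_map _ r ▸ hv)
      exact z.2 hz
    have heq : Walk.cons h.symm p = q :=
      congrArg Subtype.val ((hT.isAcyclic.subsingleton_path u w).elim ⟨_, hq⟩ ⟨q, hq'⟩)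
    exact hvq (heq ▸ by simp)

/-- The transmissions of adjacent vertices `v`, `u` of a tree differ by the numbers of vertices
on the two sides of the edge between them. -/
lemma IsTree.sum_dist_add_two_mul_ncard [Fintype V] (hT : T.IsTree) {v : V}
    (u : ({v}ᶜ : Set V)) (h : T.Adj v u) :
    (∑ w, T.dist u w) + 2 * ((T.induce ({v}ᶜ : Set V)).connectedComponentMk u).supp.ncard =
      (∑ w, T.dist v w) + Fintype.card V := by
  classical
  set c := (T.induce ({v}ᶜ : Set V)).connectedComponentMk u with hc
  have hS : c.supp.ncard = ∑ w, if w ∈ Subtype.val '' c.supp then 1 else 0 := by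
    rw [← Set.ncard_image_of_injective _ Subtype.val_injective, Finset.sum_boole,
      Nat.cast_id, ← Set.ncard_coe_finset, Finset.coe_filter_univ, Set.ofPred_mem_eq]
  have hn : Fintype.card V = ∑ _w : V, 1 := by simp
  rw [hS, hn, Finset.mul_sum, ← Finset.sum_add_distrib, ← Finset.sum_add_distrib]
  refine Finset.sum_congr rfl fun w _ => ?_
  by_cases hw : w = v
  · subst hw
    have : T.dist (u : V) w = 1 := dist_eq_one_iff_adj.mpr h.symm
    simp [this]
  · have hiff := hT.dist_add_one_iff_reachable_induce h u.2 hw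
    have hmem : w ∈ Subtype.val '' c.supp ↔
        (T.induce ({v}ᶜ : Set V)).Reachable ⟨w, hw⟩ u := by
      simp [hc, hw]
    have hor := hT.dist_eq_dist_add_one_of_adj w h
    simp only [dist_comm (u := w)] at hor
    split_ifs with hm
    · have := hiff.mpr (hmem.mp hm)
      omega
    · have := fun hh => hm (hmem.mpr (hiff.mp hh))
      have := hor.resolve_left this
      omega

/-- The orders of the components of a finite graph add up to its order. -/
lemma sum_ncard_supp [Fintype V] (G : SimpleGraph V) [Fintype G.ConnectedComponent] :
    ∑ c : G.ConnectedComponent, c.supp.ncard = Fintype.card V := by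
  classical
  rw [← Finset.card_univ, Finset.card_eq_sum_card_fiberwise (f := G.connectedComponentMk)
    (t := Finset.univ) (by simp)]
  refine Finset.sum_congr rfl fun c _ => ?_
  rw [← Set.ncard_coe_finset]
  congr 1
  ext x
  simp

end SimpleGraph

/-- Let `T` be a finite transmission irregular tree of order `n ≥ 2` and
`v` a vertex of minimum transmission.  Then `T - v` has at least `3` connected components,
and the orders of the components are pairwise distinct and each strictly less than `n/2`. -/
theorem min_transmission_vertex_components {V : Type*} [Fintype V]
    (T : SimpleGraph V) (hT : T.IsTree) (hn : 2 ≤ Fintype.card V)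
    (hTI : ∀ x y : V, (∑ w, T.dist x w) = (∑ w, T.dist y w) → x = y)
    (v : V) (hv : ∀ x : V, (∑ w, T.dist v w) ≤ ∑ w, T.dist x w) :
    3 ≤ Nat.card ((T.induce ({v}ᶜ : Set V)).ConnectedComponent) ∧
    (∀ c₁ c₂ : (T.induce ({v}ᶜ : Set V)).ConnectedComponent,
        c₁ ≠ c₂ → c₁.supp.ncard ≠ c₂.supp.ncard) ∧
    (∀ c : (T.induce ({v}ᶜ : Set V)).ConnectedComponent,
        (c.supp.ncard : ℝ) < (Fintype.card V : ℝ) / 2) := by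
  classical
  have hlt (c : (T.induce ({v}ᶜ : Set V)).ConnectedComponent) :
      2 * c.supp.ncard < Fintype.card V := by
    obtain ⟨u, hu, rfl⟩ := hT.connected.exists_adj_mem_supp c
    have h1 := hT.sum_dist_add_two_mul_ncard u hu
    have h2 := (hv u).lt_of_ne fun h => hu.ne (hTI _ _ h)
    omega
  have hne (c₁ c₂ : (T.induce ({v}ᶜ : Set V)).ConnectedComponent) (hc : c₁ ≠ c₂) :
      c₁.supp.ncard ≠ c₂.supp.ncard := by
    obtain ⟨u₁, hu₁, rfl⟩ := hT.connected.exists_adj_mem_supp c₁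
    obtain ⟨u₂, hu₂, rfl⟩ := hT.connected.exists_adj_mem_supp c₂
    intro h
    have h1 := hT.sum_dist_add_two_mul_ncard u₁ hu₁
    have h2 := hT.sum_dist_add_two_mul_ncard u₂ hu₂
    exact hc (congrArg _ (Subtype.ext (hTI u₁ u₂ (by omega))))
  refine ⟨?_, hne, fun c => ?_⟩
  · have hfin : Fintype (T.induce ({v}ᶜ : Set V)).ConnectedComponent := Fintype.ofFinite _
    have hsum := (T.induce ({v}ᶜ : Set V)).sum_ncard_supp
    rw [Fintype.card_compl_set, Set.card_singleton] at hsum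
    rw [Nat.card_eq_fintype_card, ← Finset.card_univ]
    by_contra! hk
    interval_cases hcard :
      (Finset.univ : Finset (T.induce ({v}ᶜ : Set V)).ConnectedComponent).card
    · rw [Finset.card_eq_zero.mp hcard, Finset.sum_empty] at hsum
      omega
    · obtain ⟨a, ha⟩ := Finset.card_eq_one.mp hcard
      rw [ha, Finset.sum_singleton] at hsum
      have := hlt a
      omega
    · obtain ⟨a, b, hab, huniv⟩ := Finset.card_eq_two.mp hcard
      rw [huniv, Finset.sum_pair hab] at hsum
      have := hlt a
      have := hlt b
      have := hne a b hab
      omega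
  · have : (2 * c.supp.ncard : ℝ) < Fintype.card V := by exact_mod_cast hlt c
    linarith
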